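/- Let p be an odd prime and let a, t be p-integral rational numbers with t \not\equiv 0, 1 (mod p). Then \sum_{k=0}^{p-1} \binom{a}{k}^2 t^k \equiv (t-1)^{2\langle a \rangle_p} \sum_{k=0}^{p-1} \binom{-1-a}{k}^2 t^k (mod p), where \langle a \rangle_p \in {0,...,p-1} is the residue of a mod p. -/

import Mathlib

/-- The generalized binomial coefficient `a(a-1)⋯(a-k+1)/k!`. -/
def gchoose (a : ℚ) (k : ℕ) : ℚ :=
  (∏ i ∈ Finset.range k, (a - i)) / (Nat.factorial k)

/-- A rational number is `p`-integral if `p` does not divide its denominator. -/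
def pInt (p : ℕ) (r : ℚ) : Prop := ¬ (p ∣ r.den)

/-- Congruence modulo `p` in the ring of `p`-integral rationals:
`r ≡ s (mod p)` iff `r - s = p·c` for some `p`-integral rational `c`. -/
def pCong (p : ℕ) (r s : ℚ) : Prop := ∃ c : ℚ, pInt p c ∧ r - s = p * c

theorem nat_id (n j : ℕ) (hj : j ≤ n) :
    ∑ k ∈ Finset.range (n+1), n.choose k ^ 2 * k.choose (n-j) = n.choose j * (n+j).choose j := by
  rw [← Finset.sum_range_reflect, Nat.add_choose_eq, Finset.Nat.sum_antidiagonal_eq_sum_range_succ_mk,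
    Finset.mul_sum]
  symm
  apply Finset.sum_subset_zero_on_sdiff
  · intro x; simp; omega
  · intro x hx
    simp at hx
    rw [Nat.choose_eq_zero_of_lt (show n + 1 - 1 - x < n - j by omega)]; simp
  · intro k hk
    simp at hk
    have h1 : n.choose j * j.choose k = n.choose k * (n-k).choose (j-k) :=
      Nat.choose_mul (by omega)
    have h2 : n + 1 - 1 - k = n - k := by omega
    have h3 : (n-k).choose (n-j) = (n-k).choose (j-k) := by
      rw [← Nat.choose_symm (show j - k ≤ n - k by omega)]; congr 1; omega
    simp only [h2]
    rw [Nat.choose_symm (show k ≤ n by omega), h3, Nat.choose_symm (show k ≤ j by omega)]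
    calc _ = n.choose k * (n.choose j * j.choose k) := by ring
      _ = _ := by rw [h1]; ring

theorem trunc_sum {F : Type*} [Semiring F] (n N : ℕ) (h : n < N) (f : ℕ → F)
    (hf : ∀ k, n < k → f k = 0) : ∑ k ∈ Finset.range N, f k = ∑ k ∈ Finset.range (n+1), f k := by
  symm
  apply Finset.sum_subset
  · intro x; simp; omega
  · intro x _ hx
    simp at hx
    exact hf x (by omega)

theorem field_id {F : Type*} [Field F] (n N : ℕ) (h : n < N) (u : F) (hu : u ≠ 0) :
    ∑ k ∈ Finset.range N, (n.choose k : F) ^ 2 * (u + 1) ^ k =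
      u ^ n * ∑ j ∈ Finset.range N, (n.choose j : F) * ((n+j).choose j : F) * u⁻¹ ^ j := by
  rw [trunc_sum n N h _ (fun k hk => by simp [Nat.choose_eq_zero_of_lt hk]),
    trunc_sum n N h _ (fun k hk => by simp [Nat.choose_eq_zero_of_lt hk])]
  have e : ∀ k ∈ Finset.range (n+1), (n.choose k : F) ^ 2 * (u + 1) ^ k =
      ∑ j ∈ Finset.range (n+1), (n.choose k : F) ^ 2 * (k.choose (n-j) : F) * u ^ (n-j) := by
    intro k hk
    simp at hk
    rw [add_pow]
    simp only [one_pow, mul_one]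
    rw [← trunc_sum k (n+1) (by omega) (fun i => u ^ i * (k.choose i : F)) (fun i hi => by simp [Nat.choose_eq_zero_of_lt hi]),
      ← Finset.sum_range_reflect, Finset.mul_sum]
    apply Finset.sum_congr rfl
    intro j _
    rw [show n + 1 - 1 - j = n - j by omega]; ring
  rw [Finset.sum_congr rfl e, Finset.sum_comm, Finset.mul_sum]
  apply Finset.sum_congr rfl
  intro j hj
  have hj' : j ≤ n := by simp at hj; omega
  rw [← Finset.sum_mul]
  have := congrArg (Nat.cast : ℕ → F) (nat_id n j hj')
  push_cast at this
  rw [this, pow_sub₀ u hu hj', inv_pow]; ring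

theorem prod_desc {F : Type*} [Field F] (n k : ℕ) :
    ∏ i ∈ Finset.range k, ((n:F) - i) = (k.factorial : F) * (n.choose k : F) := by
  rw [← Nat.cast_mul, ← Nat.descFactorial_eq_factorial_mul_choose]
  induction k with
  | zero => simp
  | succ k ih =>
    rw [Finset.prod_range_succ, ih, Nat.descFactorial_succ, Nat.cast_mul, mul_comm]
    rcases le_or_gt k n with h | h
    · rw [Nat.cast_sub h]
    · simp [Nat.descFactorial_of_lt h]

theorem prod_asc {F : Type*} [Field F] (n k : ℕ) :
    ∏ i ∈ Finset.range k, (-1 - (n:F) - i) =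
      (k.factorial : F) * ((-1)^k * ((n+k).choose k : F)) := by
  rw [mul_left_comm, ← Nat.cast_mul, ← Nat.ascFactorial_eq_factorial_mul_choose]
  induction k with
  | zero => simp
  | succ k ih =>
    rw [Finset.prod_range_succ, ih, Nat.ascFactorial_succ]
    push_cast; ring

theorem fact_ne {p : ℕ} [Fact p.Prime] (k : ℕ) (hk : k < p) : (k.factorial : ZMod p) ≠ 0 := by
  rw [Ne, ZMod.natCast_eq_zero_iff, (Fact.out : p.Prime).dvd_factorial]; omega

theorem neg_cast {p : ℕ} (n m : ℕ) (h : n + m + 1 = p) : (m : ZMod p) = -1 - n := by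
  have : ((n + m + 1 : ℕ) : ZMod p) = 0 := by rw [h]; simp
  push_cast at this
  linear_combination this

theorem choose_neg {p : ℕ} [Fact p.Prime] (n m j : ℕ) (h : n + m + 1 = p) (hj : j < p) :
    (m.choose j : ZMod p) = (-1)^j * ((n+j).choose j : ZMod p) := by
  apply mul_left_cancel₀ (fact_ne j hj)
  rw [← prod_desc, ← prod_asc, neg_cast n m h]

theorem zmod_id {p : ℕ} [Fact p.Prime] (n m : ℕ) (h : n + m + 1 = p) (t : ZMod p) (ht : t ≠ 1) :
    ∑ k ∈ Finset.range p, (n.choose k : ZMod p) ^ 2 * t ^ k =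
      (t-1)^(2*n) * ∑ k ∈ Finset.range p, (m.choose k : ZMod p) ^ 2 * t ^ k := by
  obtain ⟨u, rfl⟩ : ∃ u, t = u + 1 := ⟨t - 1, by ring⟩
  have hu : u ≠ 0 := by rintro rfl; simp at ht
  rw [field_id n p (by omega) u hu, field_id m p (by omega) u hu, add_sub_cancel_right]
  have e : ∀ j ∈ Finset.range p, (m.choose j : ZMod p) * ((m+j).choose j : ZMod p) * u⁻¹ ^ j =
      (n.choose j : ZMod p) * ((n+j).choose j : ZMod p) * u⁻¹ ^ j := by
    intro j hj
    have hj := Finset.mem_range.1 hj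
    rw [choose_neg n m j h hj, choose_neg m n j (by omega) hj]; ring
  rw [Finset.sum_congr rfl e, ← mul_assoc, ← pow_add, show 2 * n + m = n + (p - 1) by omega,
    pow_add, ZMod.pow_card_sub_one_eq_one hu, mul_one]

/-- `r` is p-integral with reduction `x`. -/
def Red (p : ℕ) [Fact p.Prime] (r : ℚ) (x : ZMod p) : Prop :=
  (r.den : ZMod p) ≠ 0 ∧ (r : ZMod p) = x

section
variable {p : ℕ} [Fact p.Prime]

theorem red_den (a b : ℚ) (d : ℕ) (ha : (a.den : ZMod p) ≠ 0) (hb : (b.den : ZMod p) ≠ 0)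
    (h : d ∣ a.den * b.den) : (d : ZMod p) ≠ 0 := by
  rintro h0
  obtain ⟨c, hc⟩ := h
  have := congrArg (Nat.cast : ℕ → ZMod p) hc
  push_cast at this
  rw [h0, zero_mul] at this
  exact mul_ne_zero ha hb this

theorem Red.add {a b : ℚ} {x y : ZMod p} (ha : Red p a x) (hb : Red p b y) :
    Red p (a + b) (x + y) :=
  ⟨red_den a b _ ha.1 hb.1 (Rat.add_den_dvd a b), by
    rw [Rat.cast_add_of_ne_zero ha.1 hb.1, ha.2, hb.2]⟩

theorem Red.mul {a b : ℚ} {x y : ZMod p} (ha : Red p a x) (hb : Red p b y) :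
    Red p (a * b) (x * y) :=
  ⟨red_den a b _ ha.1 hb.1 (Rat.mul_den_dvd a b), by
    rw [Rat.cast_mul_of_ne_zero ha.1 hb.1, ha.2, hb.2]⟩

theorem red_int (z : ℤ) : Red p z z := ⟨by simp, by simp⟩

theorem red_nat (z : ℕ) : Red p z z := ⟨by simp, by simp⟩

theorem Red.neg {a : ℚ} {x : ZMod p} (ha : Red p a x) : Red p (-a) (-x) := by
  simpa using (red_int (p := p) (-1)).mul ha

theorem Red.sub {a b : ℚ} {x y : ZMod p} (ha : Red p a x) (hb : Red p b y) :
    Red p (a - b) (x - y) := by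
  simpa [sub_eq_add_neg] using ha.add hb.neg

theorem Red.pow {a : ℚ} {x : ZMod p} (ha : Red p a x) (k : ℕ) : Red p (a ^ k) (x ^ k) := by
  induction k with
  | zero => simpa using red_nat (p := p) 1
  | succ k ih => simpa [pow_succ] using ih.mul ha

theorem Red.sum {f : ℕ → ℚ} {g : ℕ → ZMod p} (N : ℕ) (h : ∀ k < N, Red p (f k) (g k)) :
    Red p (∑ k ∈ Finset.range N, f k) (∑ k ∈ Finset.range N, g k) := by
  induction N with
  | zero => simpa using red_nat (p := p) 0
  | succ k ih =>
    rw [Finset.sum_range_succ, Finset.sum_range_succ]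
    exact (ih fun i hi => h i (by omega)).add (h k (by omega))

theorem Red.prod {f : ℕ → ℚ} {g : ℕ → ZMod p} (N : ℕ) (h : ∀ k < N, Red p (f k) (g k)) :
    Red p (∏ k ∈ Finset.range N, f k) (∏ k ∈ Finset.range N, g k) := by
  induction N with
  | zero => simpa using red_nat (p := p) 1
  | succ k ih =>
    rw [Finset.prod_range_succ, Finset.prod_range_succ]
    exact (ih fun i hi => h i (by omega)).mul (h k (by omega))

theorem red_inv (d : ℕ) (hd : (d : ZMod p) ≠ 0) : Red p ((d : ℚ)⁻¹) ((d : ZMod p)⁻¹) := by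
  have h0 : d ≠ 0 := by rintro rfl; simp at hd
  have h1 : ((d : ℚ)⁻¹).den = d := by
    rw [Rat.inv_natCast_den_of_pos (Nat.pos_of_ne_zero h0)]
  have h2 : ((d : ℚ)⁻¹).num = 1 := by
    rw [Rat.inv_natCast_num_of_pos (Nat.pos_of_ne_zero h0)]
  refine ⟨by rwa [h1], ?_⟩
  rw [Rat.cast_def, h1, h2]; simp

theorem pInt_iff (r : ℚ) : pInt p r ↔ (r.den : ZMod p) ≠ 0 := by
  rw [pInt, Ne, ZMod.natCast_eq_zero_iff]

theorem pCong_of_red {r s : ℚ} {x : ZMod p} (hr : Red p r x) (hs : Red p s x) : pCong p r s := by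
  have h := hr.sub hs
  rw [sub_self] at h
  obtain ⟨h1, h2⟩ := h
  rw [Rat.cast_def, div_eq_zero_iff, or_iff_left h1, ZMod.intCast_zmod_eq_zero_iff_dvd] at h2
  obtain ⟨c, hc⟩ := h2
  refine ⟨c * ((r - s).den : ℚ)⁻¹, ?_, ?_⟩
  · rw [pInt_iff]
    exact ((red_int c).mul (red_inv _ h1)).1
  · rw [← mul_assoc, ← div_eq_mul_inv]
    nth_rewrite 1 [← Rat.num_div_den (r - s)]
    rw [hc]; push_cast; rfl

theorem red_of_pCong {r s : ℚ} {x : ZMod p} (h : pCong p r s) (hs : Red p s x) : Red p r x := by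
  obtain ⟨c, hc, h⟩ := h
  rw [pInt_iff] at hc
  have := hs.add ((red_nat p).mul (⟨hc, rfl⟩ : Red p c _))
  rw [← h] at this
  simpa using this

theorem red_gchoose {a : ℚ} {n : ℕ} (ha : Red p a n) (k : ℕ) (hk : k < p) :
    Red p (gchoose a k) (n.choose k : ZMod p) := by
  have h := (Red.prod k fun i _ => ha.sub (red_nat i)).mul (red_inv _ (fact_ne k hk))
  rw [prod_desc, mul_comm _ (n.choose k : ZMod p), mul_assoc, mul_inv_cancel₀ (fact_ne k hk),
    mul_one] at h
  exact h

end

theorem sum_gchoose_sq_neg_congr (p : ℕ) (hp : p.Prime) (hodd : Odd p)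
    (a t : ℚ) (ha : pInt p a) (ht : pInt p t)
    (ht0 : ¬ pCong p t 0) (ht1 : ¬ pCong p t 1)
    (n : ℕ) (hn : n < p) (han : pCong p a n) :
    pCong p (∑ k ∈ Finset.range p, gchoose a k ^ 2 * t ^ k)
      ((t - 1) ^ (2 * n) * ∑ k ∈ Finset.range p, gchoose (-1 - a) k ^ 2 * t ^ k) := by
  haveI : Fact p.Prime := ⟨hp⟩
  have hra : Red p a n := red_of_pCong han (red_nat n)
  have hrt : Red p t (t : ZMod p) := ⟨(pInt_iff t).1 ht, rfl⟩
  have ht1' : (t : ZMod p) ≠ 1 := by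
    intro h
    rw [h] at hrt
    exact ht1 (pCong_of_red hrt (by simpa using red_nat (p := p) 1))
  obtain ⟨m, hm⟩ : ∃ m, n + m + 1 = p := ⟨p - 1 - n, by omega⟩
  have hrb : Red p (-1 - a) m := by
    rw [neg_cast n m hm]
    simpa using (red_int (p := p) (-1)).sub hra
  have h1 := Red.sum p fun k hk => ((red_gchoose hra k hk).pow 2).mul (hrt.pow k)
  have h2 := Red.sum p fun k hk => ((red_gchoose hrb k hk).pow 2).mul (hrt.pow k)
  have hr1 : Red p 1 1 := by simpa using red_nat (p := p) 1
  have h3 := ((hrt.sub hr1).pow (2 * n)).mul h2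
  rw [← zmod_id n m hm _ ht1'] at h3
  exact pCong_of_red h1 h3
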